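/- The infimum over t ∈ ℝ of the max-plus polynomial P(t) = max over j of (θ j + p j · t) equals μ; that is, inf over t ∈ ℝ of max over j of (θ j + p j · t) = μ. -/

import Mathlib

open Finset

/-- Finite maximum over `Fin n` (nonempty since `NeZero n`). -/
noncomputable def fmax {n : ℕ} [NeZero n] (f : Fin n → ℝ) : ℝ :=
  Finset.univ.sup' Finset.univ_nonempty f

theorem le_fmax {n : ℕ} [NeZero n] (f : Fin n → ℝ) (i : Fin n) : f i ≤ fmax f :=
  Finset.le_sup' f (Finset.mem_univ i)

theorem fmax_le {n : ℕ} [NeZero n] {f : Fin n → ℝ} {m : ℝ} (h : ∀ i, f i ≤ m) : fmax f ≤ m :=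
  Finset.sup'_le _ f fun i _ => h i

/-- The height at which a decreasing and an increasing line cross is below any common upper bound
of the two lines at a point. -/
theorem crossing_le {x y q r m t : ℝ} (hq : q < 0) (hr : 0 < r) (hx : x + q * t ≤ m)
    (hy : y + r * t ≤ m) : ((-r) * x + q * y) / (q - r) ≤ m := by
  rw [div_le_iff_of_neg (by linarith)]
  linarith [mul_le_mul_of_nonneg_left hx hr.le, mul_le_mul_of_nonpos_left hy hq.le]

/-- If the crossing height of a decreasing and an increasing line is at most `m`, then the
increasing line is at most `m` where the decreasing line reaches `m`. -/
theorem increasing_le_of_crossing_le {x y q r m : ℝ} (hq : q < 0) (hr : 0 < r)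
    (h : ((-r) * x + q * y) / (q - r) ≤ m) : y + r * ((m - x) / q) ≤ m := by
  rw [div_le_iff_of_neg (by linarith)] at h
  have h' : r * (m - x) / q ≤ m - y := by
    rw [div_le_iff_of_neg hq]
    linarith
  rw [mul_div_assoc] at h'
  linarith

/-- the infimum over `t : ℝ` of the max-plus polynomial
`P(t) = max_j (θ j + p j * t)` equals `μ`. -/
theorem tropical_poly_inf_eq_mu (N : ℕ) [NeZero N] (p θ : Fin N → ℝ)
    (a b : Fin N) (ha : p a < 0) (hb : 0 < p b) (μ : ℝ)
    (hμ : μ =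
      ((Finset.univ.filter (fun jk : Fin N × Fin N => p jk.1 < 0 ∧ 0 < p jk.2)).image
          (fun jk => ((-p jk.2) * θ jk.1 + p jk.1 * θ jk.2) / (p jk.1 - p jk.2)) ∪
        (Finset.univ.filter (fun j => p j = 0)).image θ).max'
        (Finset.Nonempty.inl (Finset.image_nonempty.mpr
          ⟨(a, b), Finset.mem_filter.mpr ⟨Finset.mem_univ _, ha, hb⟩⟩))) :
    (⨅ t : ℝ, fmax (fun j => θ j + p j * t)) = μ := by
  have hlower (t : ℝ) : μ ≤ fmax (fun j => θ j + p j * t) := by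
    rw [hμ]
    refine Finset.max'_le _ _ _ fun v hv => ?_
    have hle := le_fmax (fun j => θ j + p j * t)
    simp only [Finset.mem_union, Finset.mem_image, Finset.mem_filter, Finset.mem_univ,
      true_and] at hv
    rcases hv with ⟨⟨j, k⟩, ⟨hj, hk⟩, rfl⟩ | ⟨j, hj, rfl⟩
    · exact crossing_le hj hk (hle j) (hle k)
    · simpa [hj] using hle j
  have hcross (j k : Fin N) (hj : p j < 0) (hk : 0 < p k) :
      ((-p k) * θ j + p j * θ k) / (p j - p k) ≤ μ := by
    rw [hμ]
    apply Finset.le_max'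
    refine Finset.mem_union_left _ (Finset.mem_image.mpr ⟨(j, k), ?_, rfl⟩)
    simp [hj, hk]
  have hconst (j : Fin N) (hj : p j = 0) : θ j ≤ μ := by
    rw [hμ]
    apply Finset.le_max'
    refine Finset.mem_union_right _ (Finset.mem_image.mpr ⟨j, ?_, rfl⟩)
    simp [hj]
  obtain ⟨i, hi, hmax⟩ := Finset.exists_max_image (Finset.univ.filter fun j => p j < 0)
    (fun j => (μ - θ j) / p j) ⟨a, by simp [ha]⟩
  simp only [Finset.mem_filter, Finset.mem_univ, true_and] at hi hmax
  have hupper : fmax (fun j => θ j + p j * ((μ - θ i) / p i)) ≤ μ := by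
    refine fmax_le fun j => ?_
    rcases lt_trichotomy (p j) 0 with hj | hj | hj
    · have h := (div_le_iff_of_neg hj).mp (hmax j hj)
      linarith
    · simpa [hj] using hconst j hj
    · exact increasing_le_of_crossing_le hi hj (hcross i j hi hj)
  exact le_antisymm
    ((ciInf_le ⟨μ, Set.forall_mem_range.mpr hlower⟩ ((μ - θ i) / p i)).trans hupper)
    (le_ciInf hlower)
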